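/- arXiv:1304.7705 — 3 statements merged into one kernel-verified Lean document; each statement's English description precedes it below -/
import Mathlib

section
/- Let G be a simple graph on a finite vertex type V, let k ≥ 1 be a natural number, let W be a finite set of vertices of G, and let F be a set of edges of G. Suppose that every vertex u ∈ W is incident to exactly k−1 edges of F, every vertex u ∉ W is incident to no edge of F, and |W| + |F| = k + k(k−1)/2. Then |W| = k, the vertices of W are pairwise adjacent in G (i.e., W is a k-clique of G), and F is exactly the set of edges of G with both endpoints in W. -/
/-- Double counting of incidences between `W` and a set of edges all of whose
endpoints are two distinct vertices of `W`. -/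
theorem sum_card_filter_mem_eq_two_mul {V : Type*} [DecidableEq V]
    (W : Finset V) (F : Finset (Sym2 V)) (hF : ∀ e ∈ F, ¬ e.IsDiag)
    (hW : ∀ e ∈ F, ∀ u ∈ e, u ∈ W) :
    ∑ u ∈ W, (F.filter (fun e => u ∈ e)).card = 2 * F.card := by
  have h := Finset.sum_card_bipartiteAbove_eq_sum_card_bipartiteBelow
    (s := W) (t := F) (fun u e => u ∈ e)
  simp only [Finset.bipartiteAbove, Finset.bipartiteBelow] at h
  rw [h, mul_comm]
  refine Finset.sum_const_nat fun e he => ?_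
  rw [← Sym2.card_toFinset_of_not_isDiag e (hF e he)]
  congr 1
  ext u
  simpa using hW e he u

/-- **Combinatorial core of the vest construction (forward direction).**
If every vertex of `W` is incident to exactly `k-1` edges of `F ⊆ E(G)`,
every vertex outside `W` is incident to no edge of `F`, and
`|W| + |F| = k + k(k-1)/2`, then `|W| = k`, `W` is a clique of `G`, and
`F` is exactly the set of edges of `G` with both endpoints in `W`. -/
theorem degree_conditions_give_clique {V : Type*} [Fintype V] [DecidableEq V]
    (G : SimpleGraph V) [DecidableRel G.Adj] (k : ℕ) (hk : 1 ≤ k)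
    (W : Finset V) (F : Finset (Sym2 V)) (hF : F ⊆ G.edgeFinset)
    (hdeg : ∀ u ∈ W, (F.filter (fun e => u ∈ e)).card = k - 1)
    (hout : ∀ u ∉ W, (F.filter (fun e => u ∈ e)).card = 0)
    (hcard : W.card + F.card = k + k * (k - 1) / 2) :
    W.card = k ∧ ((W : Set V).Pairwise G.Adj) ∧
      F = G.edgeFinset.filter (fun e => ∀ u ∈ e, u ∈ W) := by
  have hmem : ∀ e ∈ F, ∀ u ∈ e, u ∈ W := by
    intro e he u hu
    by_contra h
    have hempty := Finset.card_eq_zero.mp (hout u h)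
    exact Finset.notMem_empty e (hempty ▸ Finset.mem_filter.mpr ⟨he, hu⟩)
  have hdiag : ∀ e ∈ F, ¬ e.IsDiag := fun e he =>
    G.not_isDiag_of_mem_edgeFinset (hF he)
  have hcount : W.card * (k - 1) = 2 * F.card := by
    rw [← sum_card_filter_mem_eq_two_mul W F hdiag hmem, Finset.sum_const_nat hdeg]
  obtain ⟨m, rfl⟩ : ∃ m, k = m + 1 := ⟨k - 1, by omega⟩
  simp only [Nat.add_sub_cancel] at hcount hcard
  have heven : 2 * ((m + 1) * m / 2) = (m + 1) * m :=
    Nat.mul_div_cancel' (by simpa [mul_comm] using (Nat.even_mul_succ_self m).two_dvd)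
  have hWcard : W.card = m + 1 :=
    Nat.eq_of_mul_eq_mul_right (Nat.succ_pos (m + 1)) (by linarith)
  have hsub : F ⊆ W.offDiag.image Sym2.mk.uncurry := by
    intro e he
    induction e using Sym2.ind with
    | _ a b =>
      exact Finset.mem_image.mpr ⟨(a, b), Finset.mem_offDiag.mpr
        ⟨hmem _ he a (Sym2.mem_mk_left a b), hmem _ he b (Sym2.mem_mk_right a b),
          fun h => hdiag _ he (Sym2.mk_isDiag_iff.mpr h)⟩, rfl⟩
  have hF_eq : F = W.offDiag.image Sym2.mk.uncurry := by
    refine Finset.eq_of_subset_of_card_le hsub ?_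
    rw [Sym2.card_image_offDiag, Nat.choose_two_right, hWcard, Nat.add_sub_cancel]
    omega
  have hpair : ∀ a ∈ W, ∀ b ∈ W, a ≠ b → s(a, b) ∈ F := fun a ha b hb hab =>
    hF_eq ▸ Finset.mem_image.mpr ⟨(a, b), Finset.mem_offDiag.mpr ⟨ha, hb, hab⟩, rfl⟩
  refine ⟨hWcard, fun a ha b hb hab => ?_, ?_⟩
  · simpa using hF (hpair a ha b hb hab)
  · ext e
    refine ⟨fun he => Finset.mem_filter.mpr ⟨hF he, hmem e he⟩, fun he => ?_⟩
    obtain ⟨heG, heW⟩ := Finset.mem_filter.mp he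
    induction e using Sym2.ind with
    | _ a b =>
      exact hpair a (heW a (Sym2.mem_mk_left a b)) b (heW b (Sym2.mem_mk_right a b))
        (G.ne_of_adj (by simpa using heG))
end

section
/- Let G be a simple graph on a finite vertex type V and let k ≥ 1 be a natural number. The number of pairs (W, F), where W is a finite set of vertices, F is a set of edges of G, every vertex u ∈ W is incident to exactly k−1 edges of F, every vertex u ∉ W is incident to no edge of F, and |W| + |F| = k + k(k−1)/2, equals the number of k-cliques of G. -/
namespace Finset

variable {V : Type*} [DecidableEq V]

/-- The unordered pairs of distinct elements of `W`. -/
def distinctPairs (W : Finset V) : Finset (Sym2 V) :=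
  W.sym2.filter fun e => ¬ e.IsDiag

theorem mk_mem_distinctPairs {W : Finset V} {a b : V} :
    s(a, b) ∈ W.distinctPairs ↔ (a ∈ W ∧ b ∈ W) ∧ a ≠ b := by
  simp [distinctPairs]

theorem card_distinctPairs (W : Finset V) : W.distinctPairs.card = W.card.choose 2 := by
  rw [← Sym2.card_image_offDiag]
  congr 1
  ext e
  induction e with
  | _ a b =>
    rw [mk_mem_distinctPairs]
    simp only [mem_image, mem_offDiag, Prod.exists]
    grind

theorem card_filter_mem_distinctPairs {W : Finset V} {u : V} (hu : u ∈ W) :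
    (W.distinctPairs.filter fun e => u ∈ e).card = W.card - 1 := by
  have himage : (W.distinctPairs.filter fun e => u ∈ e) = (W.erase u).image fun v => s(u, v) := by
    ext e
    induction e with
    | _ a b =>
      simp only [mem_filter, mk_mem_distinctPairs, mem_image, mem_erase, Sym2.eq_iff, Sym2.mem_iff]
      grind
  rw [himage, card_image_of_injective _ fun a b h => Sym2.congr_right.1 h, card_erase_of_mem hu]

theorem sum_card_filter_mem_of_subset_distinctPairs {W : Finset V} {F : Finset (Sym2 V)}
    (hF : F ⊆ W.distinctPairs) :
    ∑ u ∈ W, (F.filter fun e => u ∈ e).card = 2 * F.card := by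
  have hdouble := sum_card_bipartiteAbove_eq_sum_card_bipartiteBelow (s := W) (t := F)
    fun u e => u ∈ e
  simp only [bipartiteAbove, bipartiteBelow] at hdouble
  rw [hdouble, sum_const_nat (m := 2), mul_comm]
  intro e he
  induction e with
  | _ a b =>
    obtain ⟨⟨ha, hb⟩, hab⟩ := mk_mem_distinctPairs.1 (hF he)
    rw [← card_pair hab]
    congr 1
    ext u
    simp only [mem_filter, Sym2.mem_iff, mem_insert, mem_singleton]
    grind

theorem subset_distinctPairs {G : SimpleGraph V} {W : Finset V} {F : Finset (Sym2 V)}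
    (hG : ∀ e ∈ F, e ∈ G.edgeSet) (hout : ∀ u ∉ W, (F.filter fun e => u ∈ e).card = 0) :
    F ⊆ W.distinctPairs := by
  have hmem : ∀ e ∈ F, ∀ u ∈ e, u ∈ W := by
    intro e he u hu
    by_contra huW
    exact filter_eq_empty_iff.1 (card_eq_zero.1 (hout u huW)) he hu
  intro e he
  induction e with
  | _ a b =>
    exact mk_mem_distinctPairs.2 ⟨⟨hmem _ he a (by simp), hmem _ he b (by simp)⟩,
      SimpleGraph.Adj.ne (hG _ he)⟩

end Finset

theorem SimpleGraph.isClique_iff_distinctPairs_subset {V : Type*} [DecidableEq V]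
    {G : SimpleGraph V} {W : Finset V} :
    G.IsClique W ↔ ∀ e ∈ W.distinctPairs, e ∈ G.edgeSet := by
  constructor
  · intro h e he
    induction e with
    | _ a b =>
      obtain ⟨⟨ha, hb⟩, hab⟩ := Finset.mk_mem_distinctPairs.1 he
      exact h ha hb hab
  · intro h a ha b hb hab
    exact h s(a, b) (Finset.mk_mem_distinctPairs.2 ⟨⟨ha, hb⟩, hab⟩)

open Finset in
/-- A valid pair `(W, F)` consists of a `k`-clique together with all pairs of its vertices. -/
theorem SimpleGraph.valid_pair_iff {V : Type*} [DecidableEq V]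
    (G : SimpleGraph V) {k : ℕ} (hk : 1 ≤ k) (W : Finset V) (F : Finset (Sym2 V)) :
    ((∀ e ∈ F, e ∈ G.edgeSet) ∧
        (∀ u ∈ W, (F.filter (fun e => u ∈ e)).card = k - 1) ∧
        (∀ u ∉ W, (F.filter (fun e => u ∈ e)).card = 0) ∧
        W.card + F.card = k + k * (k - 1) / 2) ↔
      G.IsNClique k W ∧ F = W.distinctPairs := by
  have htwo : 2 * (k * (k - 1) / 2) = k * (k - 1) :=
    Nat.mul_div_cancel' (Nat.even_mul_pred_self k).two_dvd
  constructor
  · rintro ⟨hG, hin, hout, hcard⟩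
    have hsub := subset_distinctPairs hG hout
    have hsum := sum_card_filter_mem_of_subset_distinctPairs hsub
    rw [sum_const_nat hin] at hsum
    have hW : W.card = k := by
      obtain ⟨m, rfl⟩ := Nat.exists_eq_add_of_le' hk
      simp only [Nat.add_sub_cancel] at *
      apply Nat.eq_of_mul_eq_mul_right (show 0 < m + 2 by omega)
      linarith
    have hF : F = W.distinctPairs := by
      refine eq_of_subset_of_card_le hsub ?_
      rw [card_distinctPairs, hW, Nat.choose_two_right]
      omega
    subst hF
    exact ⟨⟨isClique_iff_distinctPairs_subset.2 hG, hW⟩, rfl⟩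
  · rintro ⟨⟨hclique, rfl⟩, rfl⟩
    refine ⟨isClique_iff_distinctPairs_subset.1 hclique,
      fun u hu => card_filter_mem_distinctPairs hu, fun u hu => ?_, ?_⟩
    · rw [card_eq_zero, filter_eq_empty_iff]
      intro e he hue
      exact hu (mem_sym2_iff.1 (mem_filter.1 he).1 u hue)
    · rw [card_distinctPairs, Nat.choose_two_right]

/-- **Counting valid pairs `(W, F)` counts `k`-cliques.**
The number of pairs `(W, F)` with `F ⊆ E(G)` such that every vertex of `W` is
incident to exactly `k-1` edges of `F`, every vertex outside `W` is incident
to no edge of `F`, and `|W| + |F| = k + k(k-1)/2`, equals the number of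
`k`-cliques of `G`. -/
theorem card_valid_pairs_eq_card_cliques {V : Type*} [Fintype V] [DecidableEq V]
    (G : SimpleGraph V) [DecidableRel G.Adj] (k : ℕ) (hk : 1 ≤ k) :
    (Finset.univ.filter fun WF : Finset V × Finset (Sym2 V) =>
        WF.2 ⊆ G.edgeFinset ∧
        (∀ u ∈ WF.1, (WF.2.filter (fun e => u ∈ e)).card = k - 1) ∧
        (∀ u ∉ WF.1, (WF.2.filter (fun e => u ∈ e)).card = 0) ∧
        WF.1.card + WF.2.card = k + k * (k - 1) / 2).card
      = (G.cliqueFinset k).card := by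
  rw [← Finset.card_image_of_injective (G.cliqueFinset k)
    (f := fun W => (W, W.distinctPairs)) fun _ _ h => congrArg Prod.fst h]
  congr 1
  ext ⟨W, F⟩
  have hiff := G.valid_pair_iff hk W F
  simp only [Finset.mem_filter, Finset.mem_univ, true_and, Finset.subset_iff,
    SimpleGraph.mem_edgeFinset, Finset.mem_image, SimpleGraph.mem_cliqueFinset_iff,
    Prod.mk.injEq]
  constructor
  · intro h
    obtain ⟨hW, hF⟩ := hiff.1 h
    exact ⟨W, hW, rfl, hF.symm⟩
  · rintro ⟨_, hW, rfl, hF⟩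
    exact hiff.2 ⟨hW, hF.symm⟩
end

section
/- Let G be a simple graph on a finite vertex type V, let k ≥ 1 and s = k + k(k−1)/2. The number of injective sequences (x_1, …, x_s) of elements of V ⊕ E(G) whose image, written as a pair (W, F) with W ⊆ V and F ⊆ E(G), satisfies that every vertex u ∈ W is incident to exactly k−1 edges of F, every vertex u ∉ W is incident to no edge of F, and |W| + |F| = s, equals s! times the number of k-cliques of G. -/
open Finset

/-- A set of `n` elements has exactly `n!` enumerations by `Fin n`. -/
theorem card_filter_injective_and_image_eq {α : Type*} [Fintype α] [DecidableEq α] {n : ℕ}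
    (T : Finset α) (hT : T.card = n) :
    (univ.filter fun x : Fin n → α => Function.Injective x ∧ univ.image x = T).card
      = n.factorial := by
  have hcard : Fintype.card (Fin n ↪ T) = n.factorial := by
    simp [Fintype.card_embedding_eq, hT, Nat.descFactorial_self]
  rw [← hcard, ← Finset.card_univ]
  symm
  refine Finset.card_bij (fun f _ j => (f j : α)) ?_ ?_ ?_
  · intro f _
    have hinj : Function.Injective fun j => (f j : α) :=
      Subtype.val_injective.comp f.injective
    simp only [mem_filter, mem_univ, true_and]
    refine ⟨hinj, Finset.eq_of_subset_of_card_le ?_ ?_⟩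
    · intro a ha
      obtain ⟨j, -, rfl⟩ := mem_image.1 ha
      exact (f j).2
    · rw [Finset.card_image_of_injective _ hinj, hT, Finset.card_univ, Fintype.card_fin]
  · intro f _ g _ h
    ext j
    exact congrFun h j
  · intro x hx
    simp only [mem_filter, mem_univ, true_and] at hx
    have hmem : ∀ j, x j ∈ T := fun j => hx.2 ▸ mem_image_of_mem x (mem_univ j)
    exact ⟨⟨fun j => ⟨x j, hmem j⟩, fun i j h => hx.1 (congrArg Subtype.val h)⟩,
      mem_univ _, rfl⟩

/-- Handshake lemma for a set `F` of edges: if every vertex of `W` lies on `d` edges of `F` and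
every other vertex on none, then `|W| * d = 2 * |F|`. -/
theorem SimpleGraph.card_mul_eq_two_mul_card_of_incidence {V : Type*} [Fintype V] [DecidableEq V]
    (G : SimpleGraph V) {W : Finset V} {F : Finset (Sym2 V)} {d : ℕ}
    (hF : ∀ e ∈ F, e ∈ G.edgeSet)
    (hW : ∀ u ∈ W, (F.filter fun e => u ∈ e).card = d)
    (hW' : ∀ u ∉ W, (F.filter fun e => u ∈ e).card = 0) :
    W.card * d = 2 * F.card := by
  have hcount := Finset.sum_card_bipartiteAbove_eq_sum_card_bipartiteBelow
    (s := (univ : Finset V)) (t := F) (fun u e => u ∈ e)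
  have hleft : ∑ u, (F.filter fun e => u ∈ e).card = W.card * d := by
    rw [← Finset.sum_subset (Finset.subset_univ W) fun u _ hu => hW' u hu,
      Finset.sum_congr rfl hW, Finset.sum_const, smul_eq_mul]
  have hright : ∑ e ∈ F, (univ.filter fun u : V => u ∈ e).card = 2 * F.card := by
    rw [Finset.sum_congr rfl (g := fun _ => 2), Finset.sum_const, smul_eq_mul, mul_comm]
    intro e he
    rw [← Sym2.card_toFinset_of_not_isDiag e (G.not_isDiag_of_mem_edgeSet (hF e he))]
    congr 1
    ext u
    simp
  exact hleft.symm.trans (hcount.trans hright)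

/-- The pairs `(W, F)` satisfying the incidence conditions are exactly the `k`-cliques together
with all the edges they span. -/
theorem SimpleGraph.incidence_conditions_iff {V : Type*} [Fintype V] [DecidableEq V]
    (G : SimpleGraph V) {k : ℕ} (hk : 1 ≤ k) {W : Finset V} {F : Finset (Sym2 V)}
    (hF : ∀ e ∈ F, e ∈ G.edgeSet) :
    ((∀ u ∈ W, (F.filter fun e => u ∈ e).card = k - 1) ∧
      (∀ u ∉ W, (F.filter fun e => u ∈ e).card = 0) ∧
      W.card + F.card = k + k * (k - 1) / 2) ↔
    G.IsNClique k W ∧ ∀ e, e ∈ F ↔ e ∈ G.edgeSet ∧ ∀ v ∈ e, v ∈ W := by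
  obtain ⟨d, rfl⟩ : ∃ d, k = d + 1 := ⟨k - 1, by omega⟩
  have heven : 2 * ((d + 1) * d / 2) = (d + 1) * d :=
    Nat.mul_div_cancel' (by simpa using (Nat.even_mul_pred_self (d + 1)).two_dvd)
  have hstar : ∀ u, ((W.erase u).image fun v => s(u, v)).card = (W.erase u).card := fun u =>
    Finset.card_image_of_injective _ fun a b h => Sym2.congr_right.1 h
  simp only [Nat.add_sub_cancel]
  constructor
  · rintro ⟨hW, hW', hs⟩
    have hcount := G.card_mul_eq_two_mul_card_of_incidence hF hW hW'
    have hcard : W.card = d + 1 := by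
      have : W.card * (d + 2) = (d + 1) * (d + 2) := by linarith
      exact Nat.eq_of_mul_eq_mul_right (by omega) this
    have hend : ∀ e ∈ F, ∀ v ∈ e, v ∈ W := by
      intro e he v hv
      by_contra hvW
      have hempty := Finset.card_eq_zero.1 (hW' v hvW)
      exact Finset.notMem_empty e (hempty ▸ mem_filter.2 ⟨he, hv⟩)
    have hall : ∀ u ∈ W, ∀ v ∈ W, u ≠ v → s(u, v) ∈ F := by
      intro u hu v hv huv
      have hsub : (F.filter fun e => u ∈ e) ⊆ (W.erase u).image fun v => s(u, v) := by
        intro e he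
        obtain ⟨heF, hue⟩ := mem_filter.1 he
        obtain ⟨w, rfl⟩ := Sym2.mem_iff_exists.1 hue
        have hadj : G.Adj u w := hF _ heF
        exact mem_image.2
          ⟨w, mem_erase.2 ⟨hadj.ne', hend _ heF w (Sym2.mem_mk_right u w)⟩, rfl⟩
      have heq := Finset.eq_of_subset_of_card_le hsub
        (by rw [hstar, Finset.card_erase_of_mem hu, hW u hu, hcard, Nat.add_sub_cancel])
      have hmem : s(u, v) ∈ F.filter fun e => u ∈ e :=
        heq ▸ mem_image.2 ⟨v, mem_erase.2 ⟨huv.symm, hv⟩, rfl⟩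
      exact (mem_filter.1 hmem).1
    refine ⟨⟨fun u hu v hv huv => hF _ (hall u hu v hv huv), hcard⟩,
      fun e => ⟨fun he => ⟨hF e he, hend e he⟩, ?_⟩⟩
    induction e with
    | h a b =>
      rintro ⟨hab, h⟩
      have hadj : G.Adj a b := hab
      exact hall a (h a (Sym2.mem_mk_left a b)) b (h b (Sym2.mem_mk_right a b)) hadj.ne
  · rintro ⟨⟨hclique, hcard⟩, hFW⟩
    have hW : ∀ u ∈ W, (F.filter fun e => u ∈ e).card = d := by
      intro u hu
      have heq : (F.filter fun e => u ∈ e) = (W.erase u).image fun v => s(u, v) := by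
        ext e
        simp only [mem_filter, mem_image, mem_erase, hFW]
        constructor
        · rintro ⟨⟨he, hend⟩, hue⟩
          obtain ⟨w, rfl⟩ := Sym2.mem_iff_exists.1 hue
          have hadj : G.Adj u w := he
          exact ⟨w, ⟨hadj.ne', hend w (Sym2.mem_mk_right u w)⟩, rfl⟩
        · rintro ⟨w, ⟨hwu, hw⟩, rfl⟩
          refine ⟨⟨hclique hu hw hwu.symm, fun v hv => ?_⟩, Sym2.mem_mk_left u w⟩
          rcases Sym2.mem_iff.1 hv with rfl | rfl <;> assumption
      rw [heq, hstar, Finset.card_erase_of_mem hu, hcard, Nat.add_sub_cancel]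
    have hW' : ∀ u ∉ W, (F.filter fun e => u ∈ e).card = 0 := by
      intro u hu
      rw [Finset.card_eq_zero, Finset.filter_eq_empty_iff]
      exact fun e he hue => hu (((hFW e).1 he).2 u hue)
    have hcount := G.card_mul_eq_two_mul_card_of_incidence hF hW hW'
    refine ⟨hW, hW', ?_⟩
    rw [hcard] at hcount ⊢
    omega

/-- **The `M`-sequence value of the constructed vest.**
With `s = k + k(k-1)/2`, the number of injective sequences `(x₁, …, x_s)` of
elements of `V ⊕ E(G)` whose image, written as a pair `(W, F)`, satisfies the
incidence conditions of the vest construction, equals `s!` times the number of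
`k`-cliques of `G`. -/
theorem card_injective_sequences_eq_factorial_mul_cliques {V : Type*} [Fintype V]
    [DecidableEq V] (G : SimpleGraph V) [DecidableRel G.Adj] (k : ℕ) (hk : 1 ≤ k) :
    (Finset.univ.filter fun x : Fin (k + k * (k - 1) / 2) → (V ⊕ G.edgeSet) =>
        Function.Injective x ∧
        (∀ u ∈ (Finset.univ.filter fun u : V => ∃ j, x j = Sum.inl u),
          (((Finset.univ.filter fun e : G.edgeSet => ∃ j, x j = Sum.inr e).image
              (fun (e : G.edgeSet) => (e : Sym2 V))).filter (fun e => u ∈ e)).card = k - 1) ∧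
        (∀ u ∉ (Finset.univ.filter fun u : V => ∃ j, x j = Sum.inl u),
          (((Finset.univ.filter fun e : G.edgeSet => ∃ j, x j = Sum.inr e).image
              (fun (e : G.edgeSet) => (e : Sym2 V))).filter (fun e => u ∈ e)).card = 0) ∧
        (Finset.univ.filter fun u : V => ∃ j, x j = Sum.inl u).card +
          ((Finset.univ.filter fun e : G.edgeSet => ∃ j, x j = Sum.inr e).image
            (fun (e : G.edgeSet) => (e : Sym2 V))).card = k + k * (k - 1) / 2).card
      = (k + k * (k - 1) / 2).factorial * (G.cliqueFinset k).card := by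
  classical
  set s := k + k * (k - 1) / 2
  let span : Finset V → Finset (V ⊕ G.edgeSet) := fun C =>
    C.disjSum (univ.filter fun e : G.edgeSet => ∀ v ∈ (e : Sym2 V), v ∈ C)
  have hedge : ∀ A : Finset G.edgeSet, ∀ e ∈ A.image (fun e : G.edgeSet => (e : Sym2 V)),
      e ∈ G.edgeSet := by
    intro A e he
    obtain ⟨e, -, rfl⟩ := mem_image.1 he
    exact e.2
  have hspan : ∀ C ∈ G.cliqueFinset k, (span C).card = s := by
    intro C hC
    have h := ((G.incidence_conditions_iff hk (hedge (univ.filter fun e : G.edgeSet =>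
      ∀ v ∈ (e : Sym2 V), v ∈ C))).2 ⟨G.mem_cliqueFinset_iff.1 hC, fun e => by simp [and_comm]⟩).2.2
    rwa [Finset.card_image_of_injective _ Subtype.val_injective, ← Finset.card_disjSum] at h
  rw [Finset.card_eq_sum_card_fiberwise (t := G.cliqueFinset k)
    (f := fun x => univ.filter fun u : V => ∃ j, x j = Sum.inl u)]
  · rw [Finset.sum_congr rfl (g := fun _ => s.factorial), Finset.sum_const, smul_eq_mul, mul_comm]
    intro C hC
    rw [← card_filter_injective_and_image_eq (span C) (hspan C hC)]
    congr 1
    ext x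
    have himage : univ.image x = span C ↔ (univ.filter fun u : V => ∃ j, x j = Sum.inl u) = C ∧
        ∀ e : G.edgeSet, (∃ j, x j = Sum.inr e) ↔ ∀ v ∈ (e : Sym2 V), v ∈ C := by
      simp [Finset.ext_iff, span]
    rw [mem_filter, mem_filter, mem_filter, himage]
    constructor
    · rintro ⟨⟨-, hinj, h⟩, rfl⟩
      have hF := ((G.incidence_conditions_iff hk (hedge _)).1 h).2
      refine ⟨mem_univ x, hinj, rfl, fun e => ?_⟩
      simpa using hF e
    · rintro ⟨-, hinj, rfl, hF⟩
      refine ⟨⟨mem_univ x, hinj, (G.incidence_conditions_iff hk (hedge _)).2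
        ⟨G.mem_cliqueFinset_iff.1 hC, fun e => ?_⟩⟩, rfl⟩
      simp only [mem_image, mem_filter, mem_univ, true_and] at hF ⊢
      constructor
      · rintro ⟨e, he, rfl⟩
        exact ⟨e.2, (hF e).1 he⟩
      · rintro ⟨he, h⟩
        exact ⟨⟨e, he⟩, (hF ⟨e, he⟩).2 h, rfl⟩
  · intro x hx
    have h := (mem_filter.1 hx).2.2
    exact G.mem_cliqueFinset_iff.2 ((G.incidence_conditions_iff hk (hedge _)).1 h).1
end
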